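/- arXiv:1611.02635 — 10 statements merged into one kernel-verified Lean document; each statement's English description precedes it below -/
import Mathlib

section
/- Let f : ℝ^d → ℝ be convex and differentiable, let h : ℝ^d → ℝ be differentiable, and let α, β : ℝ → ℝ be differentiable with β̇_t = e^{α_t} for all t. Suppose X : ℝ → ℝ^d is a twice differentiable curve such that, setting Z_t = X_t + e^{-α_t} Ẋ_t, the curve satisfies (d/dt) ∇h(Z_t) = − e^{α_t + β_t} ∇f(X_t) for all t. Then for every x ∈ ℝ^d, the function E_t = D_h(x, Z_t) + e^{β_t} ( f(X_t) − f(x) ) satisfies dE_t/dt ≤ 0 for all t; in particular E is nonincreasing in t. -/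
open scoped RealInnerProductSpace

/-- Bregman divergence `D_h(y, x) = h(y) - h(x) - ⟪∇h(x), y - x⟫`. -/
noncomputable def breg {E : Type*} [NormedAddCommGroup E] [InnerProductSpace ℝ E]
    [CompleteSpace E] (h : E → ℝ) (y x : E) : ℝ :=
  h y - h x - ⟪gradient h x, y - x⟫

theorem HasGradientAt.comp_hasDerivAt_inner {E : Type*} [NormedAddCommGroup E]
    [InnerProductSpace ℝ E] [CompleteSpace E] {f : E → ℝ} {X : ℝ → E} {g v : E} {t : ℝ}
    (hf : HasGradientAt f g (X t)) (hX : HasDerivAt X v t) :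
    HasDerivAt (fun s => f (X s)) ⟪g, v⟫ t := by
  simpa [Function.comp_def] using hf.hasFDerivAt.comp_hasDerivAt t hX

theorem hasDerivAt_breg_right {E : Type*} [NormedAddCommGroup E]
    [InnerProductSpace ℝ E] [CompleteSpace E] {h : E → ℝ} {Z : ℝ → E} {v w : E} {t : ℝ}
    (hh : DifferentiableAt ℝ h (Z t)) (hZ : HasDerivAt Z v t)
    (hG : HasDerivAt (fun s => gradient h (Z s)) w t) (x : E) :
    HasDerivAt (fun s => breg h x (Z s)) (-⟪w, x - Z t⟫) t := by
  have h₁ := hh.hasGradientAt.comp_hasDerivAt_inner hZ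
  have h₂ := hG.inner ℝ (hZ.const_sub x)
  refine ((h₁.const_sub (h x)).sub h₂).congr_deriv ?_
  rw [inner_neg_right]
  ring

/-- `E_t = D_h(x, Z_t) + e^{β_t}(f(X_t) - f(x))` is a Lyapunov function for the first
family of momentum dynamics `d/dt ∇h(Z_t) = -e^{α_t+β_t} ∇f(X_t)`,
`Z_t = X_t + e^{-α_t} Ẋ_t`, under the ideal scaling `β̇_t = e^{α_t}`. -/
theorem lyapunov_first_family
    {E : Type*} [NormedAddCommGroup E] [InnerProductSpace ℝ E] [FiniteDimensional ℝ E]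
    (f h : E → ℝ) (hf : Differentiable ℝ f) (hh : Differentiable ℝ h)
    (hconv : ∀ x y : E, f x + ⟪gradient f x, y - x⟫ ≤ f y)
    (α β : ℝ → ℝ) (hα : Differentiable ℝ α)
    (hβ : ∀ t, HasDerivAt β (Real.exp (α t)) t)
    (X X' X'' : ℝ → E)
    (hX : ∀ t, HasDerivAt X (X' t) t) (hX' : ∀ t, HasDerivAt X' (X'' t) t)
    (Z : ℝ → E) (hZ : ∀ t, Z t = X t + Real.exp (-α t) • X' t)
    (hode : ∀ t, HasDerivAt (fun s => gradient h (Z s))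
      (-(Real.exp (α t + β t)) • gradient f (X t)) t) :
    ∀ x : E,
      (∀ t, deriv (fun s => breg h x (Z s) + Real.exp (β s) * (f (X s) - f x)) t ≤ 0) ∧
      Antitone (fun s => breg h x (Z s) + Real.exp (β s) * (f (X s) - f x)) := by
  intro x
  have key : ∀ t, HasDerivAt (fun s => breg h x (Z s) + Real.exp (β s) * (f (X s) - f x))
      (Real.exp (α t) * Real.exp (β t) * (f (X t) + ⟪gradient f (X t), x - X t⟫ - f x)) t := by
    intro t
    have hZ' : DifferentiableAt ℝ Z t := by
      rw [funext hZ]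
      exact (hX t).differentiableAt.add ((hα t).neg.exp.smul (hX' t).differentiableAt)
    have hvel : X' t = Real.exp (α t) • (Z t - X t) := by
      rw [hZ, add_sub_cancel_left, smul_smul, ← Real.exp_add, add_neg_cancel, Real.exp_zero,
        one_smul]
    have hfX := (hf (X t)).hasGradientAt.comp_hasDerivAt_inner (hX t)
    have hD := hasDerivAt_breg_right (hh (Z t)) hZ'.hasDerivAt (hode t) x
    refine (hD.add ((hβ t).exp.mul (hfX.sub_const (f x)))).congr_deriv ?_
    rw [hvel]
    simp only [inner_smul_left, inner_smul_right, inner_sub_right, Real.exp_add, map_neg,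
      map_mul, conj_trivial]
    ring
  have hle : ∀ t, deriv (fun s => breg h x (Z s) + Real.exp (β s) * (f (X s) - f x)) t ≤ 0 := by
    intro t
    rw [(key t).deriv]
    exact mul_nonpos_of_nonneg_of_nonpos (by positivity) (sub_nonpos.2 (hconv (X t) x))
  exact ⟨hle, antitone_of_deriv_nonpos (fun t => (key t).differentiableAt) hle⟩
end

section
/- Let f : ℝ^d → ℝ be convex and differentiable, let h : ℝ^d → ℝ be convex and differentiable, and let (A_k)_{k≥0} be a strictly increasing sequence of positive reals. Suppose sequences (x_k), (z_k) in ℝ^d satisfy, for all k: ∇h(z_{k+1}) − ∇h(z_k) = −(A_{k+1} − A_k) ∇f(x_{k+1}) and (A_{k+1} − A_k) z_{k+1} = (A_{k+1} − A_k) x_{k+1} + A_k (x_{k+1} − x_k). Then for every x ∈ ℝ^d, the quantity E_k = D_h(x, z_k) + A_k ( f(x_k) − f(x) ) satisfies E_{k+1} ≤ E_k for all k. -/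
open scoped RealInnerProductSpace

/-- The Lyapunov function `E_k = D_h(x, z_k) + A_k (f(x_k) - f(x))` is nonincreasing
along the implicit-implicit Euler discretization of the first family of dynamics. -/
theorem implicit_implicit_euler_lyapunov
    {E : Type*} [NormedAddCommGroup E] [InnerProductSpace ℝ E] [FiniteDimensional ℝ E]
    (f h : E → ℝ) (hf : Differentiable ℝ f) (hh : Differentiable ℝ h)
    (hfconv : ∀ x y : E, f x + ⟪gradient f x, y - x⟫ ≤ f y)
    (hhconv : ∀ x y : E, h x + ⟪gradient h x, y - x⟫ ≤ h y)
    (A : ℕ → ℝ) (hApos : ∀ k, 0 < A k) (hAmono : StrictMono A)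
    (x z : ℕ → E)
    (hmir : ∀ k, gradient h (z (k+1)) - gradient h (z k)
      = -((A (k+1) - A k) • gradient f (x (k+1))))
    (hcoup : ∀ k, (A (k+1) - A k) • z (k+1)
      = (A (k+1) - A k) • x (k+1) + A k • (x (k+1) - x k)) :
    ∀ (w : E) (k : ℕ),
      breg h w (z (k+1)) + A (k+1) * (f (x (k+1)) - f w)
        ≤ breg h w (z k) + A k * (f (x k) - f w) := by
  intro w k
  have hgap : 0 < A (k+1) - A k := sub_pos.mpr (hAmono k.lt_succ_self)
  have hw := mul_le_mul_of_nonneg_left (hfconv (x (k+1)) w) hgap.le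
  have hx := mul_le_mul_of_nonneg_left (hfconv (x (k+1)) (x k)) (hApos k).le
  have hz := hhconv (z k) (z (k+1))
  have mirror := congrArg (fun v => ⟪v, w - z (k+1)⟫) (hmir k)
  have coupling := congrArg (fun v => ⟪gradient f (x (k+1)), v⟫) (hcoup k)
  simp only [breg, inner_sub_left, inner_sub_right, inner_add_right, inner_neg_left,
    real_inner_smul_left, real_inner_smul_right] at *
  linarith
end

section
/- Let p ≥ 2 be a real number, σ > 0, let h : ℝ^d → ℝ be differentiable with D_h(x,y) ≥ (σ/p)‖x − y‖^p for all x, y, and let f : ℝ^d → ℝ be convex and differentiable. Let (A_k)_{k≥0} be a strictly increasing sequence of positive reals and set τ_k = (A_{k+1} − A_k)/A_{k+1}. Suppose sequences (x_k), (y_k), (z_k) in ℝ^d satisfy, for all k: x_{k+1} = τ_k z_k + (1 − τ_k) y_k and ∇h(z_{k+1}) = ∇h(z_k) − (A_{k+1} − A_k) ∇f(x_{k+1}). Then, for the minimizer x* of f, the quantity E_k = D_h(x*, z_k) + A_k ( f(y_k) − f(x*) ) satisfies E_{k+1} − E_k ≤ ((p−1)/p) σ^{−1/(p−1)} (A_{k+1}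 − A_k)^{p/(p−1)} ‖∇f(x_{k+1})‖^{p/(p−1)} + A_{k+1} ( f(y_{k+1}) − f(x_{k+1}) ) for all k. -/
open scoped RealInnerProductSpace

/-- The three-point identity for Bregman divergences. -/
theorem breg_sub_breg {E : Type*} [NormedAddCommGroup E] [InnerProductSpace ℝ E]
    [CompleteSpace E] (h : E → ℝ) (u v w : E) :
    breg h u w - breg h u v = ⟪gradient h v - gradient h w, u - w⟫ - breg h w v := by
  simp only [breg, inner_sub_left, inner_sub_right]
  ring

/-- Young's inequality with exponent `p` and a weight `σ`. -/
theorem mul_le_weighted_young {p σ a b : ℝ} (hp : 1 < p) (hσ : 0 < σ) (ha : 0 ≤ a)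
    (hb : 0 ≤ b) :
    a * b ≤ σ / p * b ^ p + (p - 1) / p * σ ^ (-(1 / (p - 1))) * a ^ (p / (p - 1)) := by
  have hp0 : p ≠ 0 := by linarith
  have hp1 : p - 1 ≠ 0 := by linarith
  have hY := Real.young_inequality_of_nonneg (a := σ ^ (1 / p) * b) (b := σ ^ (-(1 / p)) * a)
    (by positivity) (by positivity) (Real.HolderConjugate.conjExponent hp)
  have hL : σ ^ (1 / p) * b * (σ ^ (-(1 / p)) * a) = a * b := by
    have hinv : σ ^ (1 / p) * σ ^ (-(1 / p)) = 1 := by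
      rw [← Real.rpow_add hσ, add_neg_cancel, Real.rpow_zero]
    linear_combination a * b * hinv
  rw [hL, Real.mul_rpow (by positivity) hb, Real.mul_rpow (by positivity) ha,
    ← Real.rpow_mul hσ.le, ← Real.rpow_mul hσ.le, one_div_mul_cancel hp0, Real.rpow_one] at hY
  have hexp : -(1 / p) * (p / (p - 1)) = -(1 / (p - 1)) := by field_simp
  rw [Real.conjExponent, hexp] at hY
  convert hY using 2
  · ring
  · field_simp

/-- Error bound for the first accelerated gradient family: using only the coupling update
`x_{k+1} = τ_k z_k + (1-τ_k) y_k` and the mirror update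
`∇h(z_{k+1}) = ∇h(z_k) - (A_{k+1}-A_k) ∇f(x_{k+1})`, the Lyapunov function
`E_k = D_h(x*, z_k) + A_k (f(y_k) - f(x*))` satisfies `E_{k+1} - E_k ≤ ε_{k+1}` with
`ε_{k+1} = ((p-1)/p) σ^{-1/(p-1)} (A_{k+1}-A_k)^{p/(p-1)} ‖∇f(x_{k+1})‖^{p/(p-1)}
  + A_{k+1} (f(y_{k+1}) - f(x_{k+1}))`. -/
theorem accelerated_family_error_bound_first
    {E : Type*} [NormedAddCommGroup E] [InnerProductSpace ℝ E] [FiniteDimensional ℝ E]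
    (p σ : ℝ) (hp : 2 ≤ p) (hσ : 0 < σ)
    (h : E → ℝ) (hh : Differentiable ℝ h)
    (hunif : ∀ x y : E, σ / p * ‖x - y‖ ^ p ≤ breg h x y)
    (f : E → ℝ) (hf : Differentiable ℝ f)
    (hconv : ∀ x y : E, f x + ⟪gradient f x, y - x⟫ ≤ f y)
    (A : ℕ → ℝ) (hApos : ∀ k, 0 < A k) (hAmono : StrictMono A)
    (x y z : ℕ → E)
    (hcoup : ∀ k, x (k+1) = ((A (k+1) - A k) / A (k+1)) • z k
      + (1 - (A (k+1) - A k) / A (k+1)) • y k)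
    (hmir : ∀ k, gradient h (z (k+1))
      = gradient h (z k) - (A (k+1) - A k) • gradient f (x (k+1)))
    (xstar : E) (hmin : ∀ w : E, f xstar ≤ f w) :
    ∀ k : ℕ,
      (breg h xstar (z (k+1)) + A (k+1) * (f (y (k+1)) - f xstar))
          - (breg h xstar (z k) + A k * (f (y k) - f xstar))
        ≤ (p - 1) / p * σ ^ (-(1 / (p - 1))) * (A (k+1) - A k) ^ (p / (p - 1))
            * ‖gradient f (x (k+1))‖ ^ (p / (p - 1))
          + A (k+1) * (f (y (k+1)) - f (x (k+1))) := by
  intro k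
  set a := A (k + 1) - A k with ha_def
  set g := gradient f (x (k + 1))
  have ha : 0 < a := sub_pos.mpr (hAmono k.lt_succ_self)
  have hA' : A (k + 1) ≠ 0 := (hApos (k + 1)).ne'
  have hthree := breg_sub_breg h xstar (z k) (z (k + 1))
  rw [hmir k, sub_sub_cancel, real_inner_smul_left] at hthree
  have hyoung := mul_le_weighted_young (p := p) (by linarith) hσ
    (mul_nonneg ha.le (norm_nonneg g)) (norm_nonneg (z (k + 1) - z k))
  rw [Real.mul_rpow ha.le (norm_nonneg g)] at hyoung
  have hcs : a * ⟪g, z k - z (k + 1)⟫ ≤ a * ‖g‖ * ‖z (k + 1) - z k‖ := by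
    rw [mul_assoc, norm_sub_rev]
    exact mul_le_mul_of_nonneg_left (real_inner_le_norm _ _) ha.le
  have hx : A (k + 1) • x (k + 1) = a • z k + A k • y k := by
    rw [hcoup k, smul_add, smul_smul, smul_smul, mul_div_cancel₀ _ hA', mul_sub,
      mul_div_cancel₀ _ hA', mul_one, sub_sub_cancel]
  have hinner := congrArg (fun v => ⟪g, v⟫) hx
  simp only [inner_add_right, real_inner_smul_right] at hinner
  have hstar := mul_le_mul_of_nonneg_left (hconv (x (k + 1)) xstar) ha.le
  have hy := mul_le_mul_of_nonneg_left (hconv (x (k + 1)) (y k)) (hApos k).le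
  have hD := hunif (z (k + 1)) (z k)
  have hAk : A (k + 1) = A k + a := by rw [ha_def]; ring
  rw [hAk] at hinner ⊢
  change a * (_ + ⟪g, _⟫) ≤ _ at hstar
  change A k * (_ + ⟪g, _⟫) ≤ _ at hy
  simp only [inner_sub_right] at hthree hcs hstar hy
  linarith
end

section
/- Let σ, ε > 0, let h : ℝ^d → ℝ be differentiable and σ-strongly convex (D_h(x,y) ≥ (σ/2)‖x − y‖² for all x, y), and let f : ℝ^d → ℝ be convex and differentiable with (1/ε)-Lipschitz gradient, attaining its minimum at x*. Let (A_k)_{k≥0} be a strictly increasing sequence of positive reals satisfying (A_{k+1} − A_k)² ≤ ε σ A_{k+1} for all k, and set τ_k = (A_{k+1} − A_k)/A_{k+1}. Suppose sequences (x_k), (y_k), (z_k) satisfy, for all k: x_{k+1} = τ_k z_k + (1 − τ_k) y_k, ∇h(z_{k+1}) = ∇h(z_k) − (A_{k+1} − A_k) ∇f(x_{k+1}), and y_{k+1} = x_{k+1} − ε ∇f(x_{k+1}). Then E_k = D_h(x*, z_k) + A_k ( f(y_k) − f(x*) ) satisfies E_{k+1} ≤ E_k for all k, and consequently f(y_k)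 − f(x*) ≤ ( D_h(x*, z_0) + A_0 ( f(y_0) − f(x*) ) ) / A_k for all k ≥ 1. -/
open scoped RealInnerProductSpace

/-- Young's inequality for inner products, with weight `σ`. -/
theorem real_inner_le_sq_div_add_sq {E : Type*} [NormedAddCommGroup E]
    [InnerProductSpace ℝ E] {σ : ℝ} (hσ : 0 < σ) (u v : E) :
    ⟪u, v⟫ ≤ ‖u‖ ^ 2 / (2 * σ) + σ / 2 * ‖v‖ ^ 2 := by
  refine (real_inner_le_norm u v).trans ?_
  have : ‖u‖ ^ 2 / (2 * σ) + σ / 2 * ‖v‖ ^ 2 - ‖u‖ * ‖v‖ = (‖u‖ - σ * ‖v‖) ^ 2 / (2 * σ) := by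
    field_simp
    ring
  have : 0 ≤ (‖u‖ - σ * ‖v‖) ^ 2 / (2 * σ) := by positivity
  linarith

section

variable {E : Type*} [NormedAddCommGroup E] [InnerProductSpace ℝ E] [CompleteSpace E]

/-- The descent lemma: a function with `L`-Lipschitz gradient lies below its quadratic
upper models. -/
theorem le_add_inner_gradient_add_sq {f : E → ℝ} (hf : Differentiable ℝ f) {L : ℝ}
    (hlip : ∀ u v : E, ‖gradient f u - gradient f v‖ ≤ L * ‖u - v‖) (u d : E) :
    f (u + d) ≤ f u + ⟪gradient f u, d⟫ + L / 2 * ‖d‖ ^ 2 := by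
  let φ : ℝ → ℝ := fun t => f (u + t • d) - (t * ⟪gradient f u, d⟫ + L / 2 * ‖d‖ ^ 2 * t ^ 2)
  have hφ : ∀ t, HasDerivAt φ
      (⟪gradient f (u + t • d) - gradient f u, d⟫ - L * ‖d‖ ^ 2 * t) t := by
    intro t
    have hline : HasDerivAt (fun t : ℝ => u + t • d) d t := by
      simpa using ((hasDerivAt_id t).smul_const d).const_add u
    have hcomp := (hf (u + t • d)).hasGradientAt.hasFDerivAt.comp_hasDerivAt t hline
    have hpoly := ((hasDerivAt_id t).mul_const ⟪gradient f u, d⟫).add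
      (((hasDerivAt_id t).pow 2).const_mul (L / 2 * ‖d‖ ^ 2))
    refine (hcomp.sub hpoly).congr_deriv ?_
    simp only [InnerProductSpace.toDual_apply_apply, inner_sub_left, id]
    push_cast
    ring
  have hanti : AntitoneOn φ (Set.Icc 0 1) := by
    refine antitoneOn_of_deriv_nonpos (convex_Icc 0 1)
      (fun t _ => (hφ t).continuousAt.continuousWithinAt)
      (fun t _ => (hφ t).differentiableAt.differentiableWithinAt) fun t ht => ?_
    rw [interior_Icc] at ht
    rw [(hφ t).deriv, sub_nonpos]
    calc ⟪gradient f (u + t • d) - gradient f u, d⟫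
        ≤ ‖gradient f (u + t • d) - gradient f u‖ * ‖d‖ := real_inner_le_norm _ _
      _ ≤ L * ‖u + t • d - u‖ * ‖d‖ := by gcongr; exact hlip _ _
      _ = L * ‖d‖ ^ 2 * t := by
        rw [add_sub_cancel_left, norm_smul, Real.norm_of_nonneg ht.1.le]
        ring
  have := hanti (Set.left_mem_Icc.2 zero_le_one) (Set.right_mem_Icc.2 zero_le_one) zero_le_one
  simp only [φ, one_smul, zero_smul, add_zero] at this
  linarith

/-- A gradient step of length `ε` decreases a function with `1 / ε`-Lipschitz gradient by at
least `ε / 2 * ‖∇f u‖ ^ 2`. -/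
theorem gradient_step_le {f : E → ℝ} (hf : Differentiable ℝ f) {ε : ℝ} (hε : 0 < ε)
    (hlip : ∀ u v : E, ‖gradient f u - gradient f v‖ ≤ (1 / ε) * ‖u - v‖) (u : E) :
    f (u - ε • gradient f u) ≤ f u - ε / 2 * ‖gradient f u‖ ^ 2 := by
  have hdesc := le_add_inner_gradient_add_sq hf hlip u (-(ε • gradient f u))
  rw [← sub_eq_add_neg, inner_neg_right, real_inner_smul_right, real_inner_self_eq_norm_sq,
    norm_neg, norm_smul, Real.norm_of_nonneg hε.le] at hdesc
  refine hdesc.trans_eq ?_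
  field_simp
  ring

/-- The three-point identity for Bregman divergences. -/
theorem breg_three_point (h : E → ℝ) (p z w : E) :
    breg h p w = breg h p z - breg h w z + ⟪gradient h z - gradient h w, p - w⟫ := by
  simp only [breg, inner_sub_left, inner_sub_right]
  ring

/-- One step of accelerated mirror descent does not increase the Lyapunov function. -/
theorem lyapunov_step_le {σ ε : ℝ} (hσ : 0 < σ) (hε : 0 < ε) {h f : E → ℝ}
    (hstrong : ∀ x y : E, σ / 2 * ‖x - y‖ ^ 2 ≤ breg h x y) (hf : Differentiable ℝ f)
    (hconv : ∀ x y : E, f x + ⟪gradient f x, y - x⟫ ≤ f y)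
    (hlip : ∀ u v : E, ‖gradient f u - gradient f v‖ ≤ (1 / ε) * ‖u - v‖)
    {a b : ℝ} (ha : 0 < a) (hab : a < b) (hcond : (b - a) ^ 2 ≤ ε * σ * b)
    {x y z z' : E} (hcoup : x = ((b - a) / b) • z + (1 - (b - a) / b) • y)
    (hmir : gradient h z' = gradient h z - (b - a) • gradient f x) (p : E) :
    breg h p z' + b * (f (x - ε • gradient f x) - f p) ≤ breg h p z + a * (f y - f p) := by
  have hb : 0 < b := ha.trans hab
  set g := gradient f x with hg
  have hcoup' : (b - a) • (x - z) = a • (y - x) := by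
    have hbx : b • x = (b - a) • z + a • y := by
      rw [hcoup, smul_add, smul_smul, smul_smul]
      congr 2 <;> field_simp
      ring
    calc (b - a) • (x - z) = b • x - a • x - (b - a) • z := by module
      _ = a • (y - x) := by rw [hbx]; module
  have hsplit : (b - a) * ⟪g, p - z'⟫
      = (b - a) * ⟪g, p - x⟫ + a * ⟪g, y - x⟫ + ⟪(b - a) • g, z - z'⟫ := by
    rw [← real_inner_smul_right g (y - x), ← hcoup']
    simp only [real_inner_smul_left, real_inner_smul_right, inner_sub_right]
    ring
  have hthree := breg_three_point h p z z'
  rw [hmir, sub_sub_cancel, real_inner_smul_left, hsplit] at hthree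
  have hyoung := real_inner_le_sq_div_add_sq hσ ((b - a) • g) (z - z')
  rw [norm_smul, mul_pow, Real.norm_eq_abs, sq_abs, norm_sub_rev z z'] at hyoung
  have hcoef : (b - a) ^ 2 * ‖g‖ ^ 2 / (2 * σ) ≤ b * (ε / 2 * ‖g‖ ^ 2) := by
    rw [div_le_iff₀ (by positivity)]
    linarith [mul_le_mul_of_nonneg_right hcond (sq_nonneg ‖g‖)]
  have hp := mul_le_mul_of_nonneg_left (hconv x p) (sub_pos.2 hab).le
  have hy := mul_le_mul_of_nonneg_left (hconv x y) ha.le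
  have hstep := mul_le_mul_of_nonneg_left (gradient_step_le hf hε hlip x) hb.le
  rw [← hg] at hp hy hstep
  linarith [hstrong z' z]

end

/-- Convergence of accelerated gradient/mirror descent: under the condition
`(A_{k+1} - A_k)² ≤ εσ A_{k+1}`, the Lyapunov function
`E_k = D_h(x*, z_k) + A_k (f(y_k) - f(x*))` is nonincreasing, and hence
`f(y_k) - f(x*) ≤ (D_h(x*, z_0) + A_0 (f(y_0) - f(x*))) / A_k`. -/
theorem accelerated_gradient_descent_convergence
    {E : Type*} [NormedAddCommGroup E] [InnerProductSpace ℝ E] [FiniteDimensional ℝ E]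
    (σ ε : ℝ) (hσ : 0 < σ) (hε : 0 < ε)
    (h : E → ℝ) (hh : Differentiable ℝ h)
    (hstrong : ∀ x y : E, σ / 2 * ‖x - y‖ ^ 2 ≤ breg h x y)
    (f : E → ℝ) (hf : Differentiable ℝ f)
    (hconv : ∀ x y : E, f x + ⟪gradient f x, y - x⟫ ≤ f y)
    (hlip : ∀ u v : E, ‖gradient f u - gradient f v‖ ≤ (1 / ε) * ‖u - v‖)
    (xstar : E) (hmin : ∀ w : E, f xstar ≤ f w)
    (A : ℕ → ℝ) (hApos : ∀ k, 0 < A k) (hAmono : StrictMono A)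
    (hAcond : ∀ k, (A (k+1) - A k) ^ 2 ≤ ε * σ * A (k+1))
    (x y z : ℕ → E)
    (hcoup : ∀ k, x (k+1) = ((A (k+1) - A k) / A (k+1)) • z k
      + (1 - (A (k+1) - A k) / A (k+1)) • y k)
    (hmir : ∀ k, gradient h (z (k+1))
      = gradient h (z k) - (A (k+1) - A k) • gradient f (x (k+1)))
    (hgrad : ∀ k, y (k+1) = x (k+1) - ε • gradient f (x (k+1))) :
    (∀ k : ℕ,
      breg h xstar (z (k+1)) + A (k+1) * (f (y (k+1)) - f xstar)
        ≤ breg h xstar (z k) + A k * (f (y k) - f xstar)) ∧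
    (∀ k : ℕ, 1 ≤ k →
      f (y k) - f xstar ≤ (breg h xstar (z 0) + A 0 * (f (y 0) - f xstar)) / A k) := by
  have hstep : ∀ k, breg h xstar (z (k+1)) + A (k+1) * (f (y (k+1)) - f xstar)
      ≤ breg h xstar (z k) + A k * (f (y k) - f xstar) := fun k => by
    rw [hgrad k]
    exact lyapunov_step_le hσ hε hstrong hf hconv hlip (hApos k) (hAmono k.lt_succ_self)
      (hAcond k) (hcoup k) (hmir k) xstar
  refine ⟨hstep, fun k _ => ?_⟩
  have hle := antitone_nat_of_succ_le
    (f := fun k => breg h xstar (z k) + A k * (f (y k) - f xstar)) hstep k.zero_le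
  have hnonneg : 0 ≤ breg h xstar (z k) := le_trans (by positivity) (hstrong xstar (z k))
  rw [le_div_iff₀ (hApos k)]
  simp only at hle
  linarith
end

section
/- Let p ≥ 3 be an integer, ν ∈ (0,1], ε > 0, N > 1, and set p̃ = p − 1 + ν. Let f : ℝ^d → ℝ be (p−1)-times continuously differentiable with (ε,ν)-Hölder-continuous (p−1)-st derivative: ‖∇^{p−1} f(x) − ∇^{p−1} f(y)‖ ≤ (1/ε)‖x − y‖^ν for all x, y. Fix x ∈ ℝ^d and suppose y ∈ ℝ^d is a minimizer of z ↦ f_{p−1}(x; z) + (N/(ε p̃)) ‖z − x‖^{p̃}, where f_{p−1}(x; z) is the (p−1)-st order Taylor expansion of f around x evaluated at z. Then ⟨∇f(y), x − y⟩ ≥ ((N² − 1)^{(p̃−2)/(2p̃−2)} / (2N)) · ε^{1/(p̃−1)} · ‖∇f(y)‖^{p̃/(p̃−1)}. -/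
open scoped RealInnerProductSpace

theorem fderiv_clm_fderiv_apply {E F G : Type*} [NormedAddCommGroup E] [NormedSpace ℝ E]
    [NormedAddCommGroup F] [NormedSpace ℝ F] [NormedAddCommGroup G] [NormedSpace ℝ G]
    {φ : E → G} {x : E} (hφ : DifferentiableAt ℝ (fderiv ℝ φ) x) (L : G →L[ℝ] F) (a b : E) :
    fderiv ℝ (fun z => L (fderiv ℝ φ z b)) x a = L (fderiv ℝ (fderiv ℝ φ) x a b) := by
  have h := ((L.comp (ContinuousLinearMap.apply ℝ G b)).hasFDerivAt.comp x hφ.hasFDerivAt).fderiv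
  exact congrArg (fun T => T a) h

/-- Symmetry of the iterated derivative when all but one of the arguments agree. -/
theorem iteratedFDeriv_update_const {E F : Type*} [NormedAddCommGroup E] [NormedSpace ℝ E]
    [NormedAddCommGroup F] [NormedSpace ℝ F] {n : ℕ} {f : E → F}
    (hf : ContDiff ℝ (n + 1 : ℕ) f) (x v w : E) (j : Fin (n + 1)) :
    iteratedFDeriv ℝ (n + 1) f x (Function.update (fun _ => v) j w) =
      iteratedFDeriv ℝ (n + 1) f x (Function.update (fun _ => v) 0 w) := by
  induction n generalizing x with
  | zero => rw [Fin.fin_one_eq_zero j]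
  | succ n ih =>
    induction j using Fin.cases with
    | zero => rfl
    | succ j =>
      have hdiff : Differentiable ℝ (iteratedFDeriv ℝ (n + 1) f) :=
        hf.differentiable_iteratedFDeriv (by norm_cast; omega)
      have hfderiv (m : Fin (n + 1) → E) (a : E) :
          fderiv ℝ (iteratedFDeriv ℝ (n + 1) f) x a m =
            fderiv ℝ (fun z => iteratedFDeriv ℝ (n + 1) f z m) x a :=
        ((ContinuousMultilinearMap.apply ℝ (fun _ : Fin (n + 1) => E) F m).hasFDerivAt.comp x
          (hdiff x).hasFDerivAt).fderiv ▸ rfl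
      have hsymm : IsSymmSndFDerivAt ℝ (iteratedFDeriv ℝ n f) x := by
        refine ContDiffAt.isSymmSndFDerivAt (n := 2) ?_ (by simp)
        refine (hf.iteratedFDeriv_right (m := 2) ?_).contDiffAt
        norm_cast
        omega
      have hfst (a b : E) (m : Fin n → E) :
          iteratedFDeriv ℝ (n + 2) f x (Fin.cons a (Fin.cons b m)) =
            fderiv ℝ (fderiv ℝ (iteratedFDeriv ℝ n f)) x a b m := by
        have hd : Differentiable ℝ (fderiv ℝ (iteratedFDeriv ℝ n f)) :=
          (hf.iteratedFDeriv_right (m := 2) (by norm_cast; omega)).fderiv_right (m := 1)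
            (by norm_num) |>.differentiable (by norm_num)
        rw [iteratedFDeriv_succ_apply_left, hfderiv]
        exact fderiv_clm_fderiv_apply (hd x)
          (ContinuousMultilinearMap.apply ℝ (fun _ : Fin n => E) F m) a b
      have hzero : (Function.update (fun _ => v) 0 w : Fin (n + 2) → E) =
          Fin.cons w (Fin.cons v fun _ => v) := by
        ext i
        refine Fin.cases ?_ (fun i => ?_) i
        · simp
        · refine Fin.cases ?_ (fun i => ?_) i <;> simp
      have hone : (Function.update (fun _ => v) 0 w : Fin (n + 1) → E) =
          Fin.cons w fun _ => v := by
        ext i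
        refine Fin.cases ?_ (fun i => ?_) i <;> simp
      have htail : Fin.tail (Function.update (fun _ => v) j.succ w : Fin (n + 2) → E) =
          Function.update (fun _ => v) j w := by
        rw [Fin.tail_update_succ]; rfl
      calc iteratedFDeriv ℝ (n + 2) f x (Function.update (fun _ => v) j.succ w)
          = fderiv ℝ (iteratedFDeriv ℝ (n + 1) f) x v (Function.update (fun _ => v) j w) := by
            rw [iteratedFDeriv_succ_apply_left, htail,
              Function.update_of_ne (Fin.succ_ne_zero j).symm]
        _ = fderiv ℝ (iteratedFDeriv ℝ (n + 1) f) x v (Function.update (fun _ => v) 0 w) := by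
            rw [hfderiv, hfderiv]
            simp_rw [fun z => ih (hf.of_le (by norm_cast; omega)) z j]
        _ = iteratedFDeriv ℝ (n + 2) f x (Fin.cons v (Fin.cons w fun _ => v)) := by
            rw [iteratedFDeriv_succ_apply_left, hone]
            rfl
        _ = iteratedFDeriv ℝ (n + 2) f x (Function.update (fun _ => v) 0 w) := by
            rw [hzero, hfst, hfst, hsymm]

theorem iteratedDeriv_comp_add_smul {E F : Type*} [NormedAddCommGroup E] [NormedSpace ℝ E]
    [NormedAddCommGroup F] [NormedSpace ℝ F] {n : ℕ} {f : E → F}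
    (hf : ContDiff ℝ n f) (x v : E) (t : ℝ) :
    iteratedDeriv n (fun s : ℝ => f (x + s • v)) t =
      iteratedFDeriv ℝ n f (x + t • v) (fun _ => v) := by
  have h := (ContinuousLinearMap.toSpanSingleton ℝ v).iteratedFDeriv_comp_right
    (f := fun z => f (x + z)) (hf.comp (contDiff_const.add contDiff_id)) t le_rfl
  rw [iteratedDeriv_eq_iteratedFDeriv]
  have := congrArg (fun T => T (fun _ => 1)) h
  simpa [Function.comp_def, iteratedFDeriv_comp_add_left] using this

/-- The derivative of a continuous symmetric form along the diagonal. -/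
theorem hasDerivAt_iteratedFDeriv_diag {E F : Type*} [NormedAddCommGroup E] [NormedSpace ℝ E]
    [NormedAddCommGroup F] [NormedSpace ℝ F] {n : ℕ} {f : E → F}
    (hf : ContDiff ℝ (n + 1 : ℕ) f) (x v w : E) :
    HasDerivAt (fun s : ℝ => iteratedFDeriv ℝ (n + 1) f x (fun _ => v + s • w))
      ((n + 1 : ℝ) • iteratedFDeriv ℝ n (fderiv ℝ f) x (fun _ => v) w) 0 := by
  have hline : HasDerivAt (fun s : ℝ => fun _ : Fin (n + 1) => v + s • w) (fun _ => w) 0 := by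
    rw [hasDerivAt_pi]
    intro _
    simpa using ((hasDerivAt_id (0 : ℝ)).smul_const w).const_add v
  have h := ((iteratedFDeriv ℝ (n + 1) f x).hasFDerivAt
    (x := fun _ => v + (0 : ℝ) • w)).comp_hasDerivAt (0 : ℝ) hline
  refine h.congr_deriv ?_
  have hlast : Fin.init (Function.update (fun _ => v) (Fin.last n) w : Fin (n + 1) → E) =
      fun _ => v := by
    rw [Fin.init_update_last]; rfl
  rw [ContinuousMultilinearMap.linearDeriv_apply]
  simp only [zero_smul, add_zero, iteratedFDeriv_update_const hf x v w]
  rw [← iteratedFDeriv_update_const hf x v w (Fin.last n), iteratedFDeriv_succ_apply_right, hlast]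
  simp [← Nat.cast_smul_eq_nsmul ℝ]

/-- Taylor's theorem with a remainder controlled by the oscillation of the top derivative. -/
theorem abs_sub_taylor_le_of_iteratedDeriv_sub_le {n : ℕ} {h : ℝ → ℝ} {C : ℝ}
    (hh : ContDiff ℝ (n + 1 : ℕ) h)
    (hC : ∀ t ∈ Set.Ioo (0 : ℝ) 1, |iteratedDeriv (n + 1) h t - iteratedDeriv (n + 1) h 0| ≤ C) :
    |h 1 - ∑ k ∈ Finset.range (n + 2), (1 / (k.factorial : ℝ)) * iteratedDeriv k h 0| ≤ C := by
  obtain ⟨t, ht, hrem⟩ := taylor_mean_remainder_lagrange_iteratedDeriv (n := n)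
    (zero_ne_one' ℝ) (by exact_mod_cast hh.contDiffOn)
  rw [Set.uIcc_of_le zero_le_one, taylor_within_apply] at hrem
  rw [Set.uIoo_of_le zero_le_one] at ht
  have hsum : ∑ k ∈ Finset.range (n + 1), ((k.factorial : ℝ)⁻¹ * (1 - 0) ^ k) •
        iteratedDerivWithin k h (Set.Icc 0 1) 0 =
      ∑ k ∈ Finset.range (n + 1), (1 / (k.factorial : ℝ)) * iteratedDeriv k h 0 := by
    refine Finset.sum_congr rfl fun k hk => ?_
    rw [iteratedDerivWithin_eq_iteratedDeriv (uniqueDiffOn_Icc zero_lt_one)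
      (hh.of_le (by have := Finset.mem_range.1 hk; norm_cast; omega)).contDiffAt (by simp)]
    simp
  rw [hsum] at hrem
  have hfac : (1 : ℝ) ≤ ((n + 1).factorial : ℝ) := by exact_mod_cast Nat.factorial_pos _
  have hdiff : h 1 - ∑ k ∈ Finset.range (n + 2), (1 / (k.factorial : ℝ)) * iteratedDeriv k h 0 =
      (iteratedDeriv (n + 1) h t - iteratedDeriv (n + 1) h 0) / ((n + 1).factorial : ℝ) := by
    rw [Finset.sum_range_succ, ← sub_sub, hrem]
    ring
  rw [hdiff, abs_div, abs_of_pos (zero_lt_one.trans_le hfac)]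
  exact (div_le_self (abs_nonneg _) hfac).trans (hC t ht)

theorem iteratedFDeriv_fderiv_apply_eq_inner {E : Type*} [NormedAddCommGroup E]
    [InnerProductSpace ℝ E] [CompleteSpace E] (f : E → ℝ) (k : ℕ) (x : E) (m : Fin k → E) (w : E) :
    iteratedFDeriv ℝ k (fderiv ℝ f) x m w = ⟪iteratedFDeriv ℝ k (gradient f) x m, w⟫ := by
  rw [← toDual_comp_gradient]
  have h := (InnerProductSpace.toDual ℝ E).toContinuousLinearEquiv.iteratedFDeriv_comp_left
    (f := gradient f) (x := x) (i := k)
  exact congrArg (fun T => T m w) h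

/-- The gradient of a function with Hölder continuous derivative of order `n + 2` is
approximated by the gradient of the Taylor polynomial. -/
theorem abs_inner_gradient_sub_taylor_le {E : Type*} [NormedAddCommGroup E]
    [InnerProductSpace ℝ E] [CompleteSpace E] {n : ℕ} {ν K : ℝ} (hν : 0 < ν) (hK : 0 ≤ K)
    {f : E → ℝ} (hf : ContDiff ℝ (n + 2 : ℕ) f)
    (hhold : ∀ x y : E, ‖iteratedFDeriv ℝ (n + 1) (gradient f) x -
      iteratedFDeriv ℝ (n + 1) (gradient f) y‖ ≤ K * ‖x - y‖ ^ ν) (x y w : E) :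
    |⟪gradient f y, w⟫ - ∑ k ∈ Finset.range (n + 2), (1 / (k.factorial : ℝ)) *
      iteratedFDeriv ℝ k (fderiv ℝ f) x (fun _ => y - x) w| ≤
      K * ‖y - x‖ ^ (n + 1 + ν) * ‖w‖ := by
  set v := y - x with hv
  have hfd : ContDiff ℝ (n + 1 : ℕ) (fderiv ℝ f) := hf.fderiv_right (by norm_cast)
  have hfw : ContDiff ℝ (n + 1 : ℕ) (fun z => fderiv ℝ f z w) := hfd.clm_apply contDiff_const
  have hderiv (k : ℕ) (hk : k ≤ n + 1) (t : ℝ) :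
      iteratedDeriv k (fun s : ℝ => fderiv ℝ f (x + s • v) w) t =
        iteratedFDeriv ℝ k (fderiv ℝ f) (x + t • v) (fun _ => v) w := by
    have hk' : (k : WithTop ℕ∞) ≤ (n + 1 : ℕ) := by exact_mod_cast hk
    rw [iteratedDeriv_comp_add_smul (f := fun z => fderiv ℝ f z w) (hfw.of_le hk')]
    have h := (ContinuousLinearMap.apply ℝ ℝ w).iteratedFDeriv_comp_left
      (x := x + t • v) hfd.contDiffAt hk'
    exact congrArg (fun T => T fun _ => v) h
  have hline : ContDiff ℝ (n + 1 : ℕ) (fun s : ℝ => fderiv ℝ f (x + s • v) w) :=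
    hfw.comp (contDiff_const.add (contDiff_id.smul contDiff_const))
  have key := abs_sub_taylor_le_of_iteratedDeriv_sub_le hline
    (C := K * ‖v‖ ^ (n + 1 + ν) * ‖w‖) ?_
  · have hsum : ∑ k ∈ Finset.range (n + 2), (1 / (k.factorial : ℝ)) *
        iteratedDeriv k (fun s : ℝ => fderiv ℝ f (x + s • v) w) 0 =
        ∑ k ∈ Finset.range (n + 2), (1 / (k.factorial : ℝ)) *
          iteratedFDeriv ℝ k (fderiv ℝ f) x (fun _ => v) w := by
      refine Finset.sum_congr rfl fun k hk => ?_
      rw [hderiv k (by have := Finset.mem_range.1 hk; omega)]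
      simp
    rw [hsum] at key
    have hy : fderiv ℝ f (x + (1 : ℝ) • v) w = ⟪gradient f y, w⟫ := by
      rw [← toDual_gradient]
      simp [hv]
    rwa [hy] at key
  · intro t ht
    rw [hderiv _ le_rfl, hderiv _ le_rfl, iteratedFDeriv_fderiv_apply_eq_inner,
      iteratedFDeriv_fderiv_apply_eq_inner, ← inner_sub_left, zero_smul, add_zero,
      ← sub_apply]
    refine (abs_real_inner_le_norm _ _).trans (mul_le_mul_of_nonneg_right ?_ (norm_nonneg w))
    refine (ContinuousMultilinearMap.le_opNorm _ _).trans ?_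
    have hpow : ‖v‖ ^ (n + 1 + ν) = ‖v‖ ^ ν * ‖v‖ ^ (n + 1) := by
      rw [add_comm, Real.rpow_add_of_nonneg (norm_nonneg v) hν.le (by positivity)]
      exact_mod_cast rfl
    have htv : ‖x + t • v - x‖ ≤ ‖v‖ := by
      rw [add_sub_cancel_left, norm_smul, Real.norm_of_nonneg ht.1.le]
      exact mul_le_of_le_one_left (norm_nonneg v) ht.2.le
    rw [hpow, ← mul_assoc, Finset.prod_const, Finset.card_fin]
    gcongr
    refine (hhold _ _).trans ?_
    gcongr

/-- First-order optimality for the regularized Taylor model. -/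
theorem taylor_model_first_order {E : Type*} [NormedAddCommGroup E]
    [InnerProductSpace ℝ E] {n : ℕ} {q c : ℝ} (hq : 1 < q)
    {f : E → ℝ} (hf : ContDiff ℝ n f) (x y w : E)
    (hy : ∀ z : E,
      (∑ i ∈ Finset.range (n + 1),
          (1 / (i.factorial : ℝ)) * iteratedFDeriv ℝ i f x (fun _ => y - x)) + c * ‖y - x‖ ^ q
      ≤ (∑ i ∈ Finset.range (n + 1),
          (1 / (i.factorial : ℝ)) * iteratedFDeriv ℝ i f x (fun _ => z - x))
        + c * ‖z - x‖ ^ q) :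
    ∑ k ∈ Finset.range n, (1 / (k.factorial : ℝ)) *
      iteratedFDeriv ℝ k (fderiv ℝ f) x (fun _ => y - x) w +
        c * q * ‖y - x‖ ^ (q - 2) * ⟪y - x, w⟫ = 0 := by
  set v := y - x with hv
  have hline : HasDerivAt (fun s : ℝ => v + s • w) w 0 := by
    simpa using ((hasDerivAt_id (0 : ℝ)).smul_const w).const_add v
  have hnorm : HasDerivAt (fun s : ℝ => ‖v + s • w‖ ^ q) (q * ‖v‖ ^ (q - 2) * ⟪v, w⟫) 0 := by
    have h := (hasFDerivAt_norm_rpow (v + (0 : ℝ) • w) hq).comp_hasDerivAt (0 : ℝ) hline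
    refine h.congr_deriv ?_
    simp
  have hmodel : HasDerivAt (fun s : ℝ => ∑ i ∈ Finset.range (n + 1),
      (1 / (i.factorial : ℝ)) * iteratedFDeriv ℝ i f x (fun _ => v + s • w))
      (∑ k ∈ Finset.range n, (1 / (k.factorial : ℝ)) *
        iteratedFDeriv ℝ k (fderiv ℝ f) x (fun _ => v) w) 0 := by
    simp_rw [Finset.sum_range_succ' _ n]
    simp only [iteratedFDeriv_zero_apply]
    refine HasDerivAt.add_const _ (HasDerivAt.fun_sum fun k hk => ?_)
    have hk' : ((k + 1 : ℕ) : WithTop ℕ∞) ≤ n := by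
      exact_mod_cast Finset.mem_range.1 hk
    refine ((hasDerivAt_iteratedFDeriv_diag (hf.of_le hk') x v w).const_mul _).congr_deriv ?_
    rw [Nat.factorial_succ, smul_eq_mul]
    push_cast
    field_simp
  have htotal := hmodel.add (hnorm.const_mul c)
  have hmin : IsLocalMin ((fun s : ℝ => ∑ i ∈ Finset.range (n + 1),
      (1 / (i.factorial : ℝ)) * iteratedFDeriv ℝ i f x (fun _ => v + s • w)) +
        fun s : ℝ => c * ‖v + s • w‖ ^ q) 0 := by
    refine Filter.Eventually.of_forall fun s => ?_
    have hz : y + s • w - x = v + s • w := by rw [hv]; abel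
    simpa [hz] using hy (y + s • w)
  rw [← hmin.hasDerivAt_eq_zero htotal]
  ring

/-- Weighted AM-GM step turning a quadratic residual bound into a power of the residual. -/
theorem rpow_lower_bound_of_sq {q ε N r G I : ℝ} (hq : 2 < q) (hε : 0 < ε) (hN : 1 < N)
    (hr : 0 < r) (hG : 0 ≤ G)
    (h : G ^ 2 + (N ^ 2 - 1) * (r ^ (q - 1) / ε) ^ 2 ≤ 2 * (N / ε) * r ^ (q - 2) * I) :
    (N ^ 2 - 1) ^ ((q - 2) / (2 * q - 2)) / (2 * N) * ε ^ (1 / (q - 1)) * G ^ (q / (q - 1)) ≤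
      I := by
  have hM : 0 < N ^ 2 - 1 := by nlinarith
  set M := N ^ 2 - 1 with hMdef
  have hN0 : 0 < N := by linarith
  have hq1 : 0 < 2 * q - 2 := by linarith
  have hq2 : q - 1 ≠ 0 := by linarith
  have hrq : 0 < r ^ (q - 2) := Real.rpow_pos_of_pos hr _
  have hrr : (r ^ (q - 1)) ^ 2 = r ^ (q - 2) * r ^ q := by
    rw [← Real.rpow_natCast, ← Real.rpow_mul hr.le, ← Real.rpow_add hr]
    congr 1
    push_cast
    ring
  set a := ε * G ^ 2 / r ^ (q - 2) with ha
  set b := M / ε * r ^ q with hb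
  have ha0 : 0 ≤ a := by positivity
  have hb0 : 0 ≤ b := by positivity
  have hab : a + b ≤ 2 * N * I := by
    have h2 : a + b = (G ^ 2 + M * (r ^ (q - 1) / ε) ^ 2) * (ε / r ^ (q - 2)) := by
      rw [div_pow, hrr, ha, hb]
      field_simp
    have h3 : 2 * N * I = 2 * (N / ε) * r ^ (q - 2) * I * (ε / r ^ (q - 2)) := by
      field_simp
    rw [h2, h3]
    gcongr
  have hθ : 0 ≤ q / (2 * q - 2) := by apply div_nonneg <;> linarith
  have hθ' : 0 ≤ (q - 2) / (2 * q - 2) := by apply div_nonneg <;> linarith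
  have hsum : q / (2 * q - 2) + (q - 2) / (2 * q - 2) = 1 := by field_simp; ring
  have hgm := Real.geom_mean_le_arith_mean2_weighted hθ hθ' ha0 hb0 hsum
  have hle : q / (2 * q - 2) * a + (q - 2) / (2 * q - 2) * b ≤ a + b := by
    have h1 : q / (2 * q - 2) ≤ 1 := by linarith
    have h2 : (q - 2) / (2 * q - 2) ≤ 1 := by linarith
    nlinarith
  have heq : a ^ (q / (2 * q - 2)) * b ^ ((q - 2) / (2 * q - 2)) =
      M ^ ((q - 2) / (2 * q - 2)) * ε ^ (1 / (q - 1)) * G ^ (q / (q - 1)) := by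
    have e1 : (G ^ 2) ^ (q / (2 * q - 2)) = G ^ (q / (q - 1)) := by
      rw [← Real.rpow_natCast, ← Real.rpow_mul hG]
      congr 1
      push_cast
      field_simp
    have e2 : (r ^ (q - 2)) ^ (q / (2 * q - 2)) = (r ^ q) ^ ((q - 2) / (2 * q - 2)) := by
      rw [← Real.rpow_mul hr.le, ← Real.rpow_mul hr.le]
      congr 1
      ring
    have e3 : ε ^ (q / (2 * q - 2)) = ε ^ (1 / (q - 1)) * ε ^ ((q - 2) / (2 * q - 2)) := by
      rw [← Real.rpow_add hε]
      congr 1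
      field_simp
      ring
    have p1 : 0 < ε ^ ((q - 2) / (2 * q - 2)) := Real.rpow_pos_of_pos hε _
    have p2 : 0 < (r ^ q) ^ ((q - 2) / (2 * q - 2)) := by positivity
    rw [ha, hb, Real.div_rpow (by positivity) hrq.le, Real.mul_rpow hε.le (by positivity),
      Real.mul_rpow (by positivity) (by positivity), Real.div_rpow hM.le hε.le, e1, e2, e3]
    field_simp
  have hfin : M ^ ((q - 2) / (2 * q - 2)) * ε ^ (1 / (q - 1)) * G ^ (q / (q - 1)) ≤ 2 * N * I := by
    rw [← heq]
    exact hgm.trans (hle.trans hab)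
  calc _ = M ^ ((q - 2) / (2 * q - 2)) * ε ^ (1 / (q - 1)) * G ^ (q / (q - 1)) / (2 * N) := by
        ring
    _ ≤ I := by
        rw [div_le_iff₀ (by positivity)]
        linarith

/-- Progress condition for the regularized higher-order gradient update: if `y` minimizes
`z ↦ f_{p-1}(x; z) + (N/(ε p̃)) ‖z - x‖^{p̃}`, where `f_{p-1}(x; ·)` is the `(p-1)`-st
order Taylor expansion of `f` around `x` and `p̃ = p - 1 + ν`, and `f` has
`(ε,ν)`-Hölder-continuous `(p-1)`-st derivative, then
`⟪∇f(y), x - y⟫ ≥ ((N²-1)^{(p̃-2)/(2p̃-2)} / (2N)) ε^{1/(p̃-1)} ‖∇f(y)‖^{p̃/(p̃-1)}`. -/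
theorem higher_order_gradient_progress
    {E : Type*} [NormedAddCommGroup E] [InnerProductSpace ℝ E] [FiniteDimensional ℝ E]
    (p : ℕ) (hp : 3 ≤ p) (ν ε N : ℝ) (hν : 0 < ν) (hν1 : ν ≤ 1) (hε : 0 < ε) (hN : 1 < N)
    (f : E → ℝ) (hf : ContDiff ℝ (p - 1 : ℕ) f)
    (hhold : ∀ x y : E,
      ‖iteratedFDeriv ℝ (p - 2) (gradient f) x - iteratedFDeriv ℝ (p - 2) (gradient f) y‖
        ≤ (1 / ε) * ‖x - y‖ ^ ν)
    (x y : E)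
    (hy : ∀ z : E,
      (∑ i ∈ Finset.range p,
          ((1 : ℝ) / (Nat.factorial i)) * iteratedFDeriv ℝ i f x (fun _ => y - x))
        + (N / (ε * ((p : ℝ) - 1 + ν))) * ‖y - x‖ ^ ((p : ℝ) - 1 + ν)
      ≤ (∑ i ∈ Finset.range p,
          ((1 : ℝ) / (Nat.factorial i)) * iteratedFDeriv ℝ i f x (fun _ => z - x))
        + (N / (ε * ((p : ℝ) - 1 + ν))) * ‖z - x‖ ^ ((p : ℝ) - 1 + ν)) :
    ((N ^ 2 - 1) ^ ((((p : ℝ) - 1 + ν) - 2) / (2 * ((p : ℝ) - 1 + ν) - 2)) / (2 * N))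
        * ε ^ (1 / (((p : ℝ) - 1 + ν) - 1))
        * ‖gradient f y‖ ^ (((p : ℝ) - 1 + ν) / (((p : ℝ) - 1 + ν) - 1))
      ≤ ⟪gradient f y, x - y⟫ := by
  obtain ⟨n, rfl⟩ : ∃ n, p = n + 3 := ⟨p - 3, by omega⟩
  have hq : (((n + 3 : ℕ) : ℝ) - 1 + ν) = n + 2 + ν := by push_cast; ring
  rw [hq] at hy ⊢
  set q : ℝ := n + 2 + ν with hqdef
  have hn : (0 : ℝ) ≤ n := n.cast_nonneg
  have hq2 : 2 < q := by linarith
  set v := y - x with hv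
  set g := gradient f y with hg
  have hopt (w : E) := taylor_model_first_order (n := n + 2) (by linarith) hf x y w hy
  have hrem (w : E) := abs_inner_gradient_sub_taylor_le hν (one_div_pos.2 hε).le hf hhold x y w
  have hexp : (n : ℝ) + 1 + ν = q - 1 := by rw [hqdef]; ring
  have hc : N / (ε * q) * q = N / ε := by field_simp
  simp only [hexp, ← hv, ← hg, hc] at hopt hrem
  set α := N / ε * ‖v‖ ^ (q - 2) with hα
  have hnorm : ‖g + α • v‖ ≤ 1 / ε * ‖v‖ ^ (q - 1) := by
    have h := (abs_le.1 (hrem (g + α • v))).2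
    have h0 := hopt (g + α • v)
    have hself : ⟪g, g + α • v⟫ + α * ⟪v, g + α • v⟫ = ‖g + α • v‖ * ‖g + α • v‖ := by
      rw [← real_inner_self_eq_norm_mul_norm, inner_add_left (x := g) (y := α • v),
        real_inner_smul_left]
    rcases (norm_nonneg (g + α • v)).eq_or_lt with hz | hz
    · rw [← hz]
      positivity
    · exact le_of_mul_le_mul_right (by linarith) hz
  rcases (norm_nonneg v).eq_or_lt with hr | hr
  · have hv0 : v = 0 := norm_eq_zero.1 hr.symm
    have hg0 : g = 0 := by
      rw [hv0, smul_zero, add_zero, norm_zero, Real.zero_rpow (by linarith), mul_zero] at hnorm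
      exact norm_le_zero_iff.1 hnorm
    rw [hg0, norm_zero, inner_zero_left, Real.zero_rpow, mul_zero]
    exact (div_pos (by linarith) (by linarith)).ne'
  · refine rpow_lower_bound_of_sq hq2 hε hN hr (norm_nonneg g) ?_
    have hsq := pow_le_pow_left₀ (norm_nonneg _) hnorm 2
    have hpow : ‖v‖ ^ (q - 1) = ‖v‖ ^ (q - 2) * ‖v‖ := by
      rw [← Real.rpow_add_one hr.ne']
      congr 1
      ring
    have hxy : ⟪g, x - y⟫ = -⟪g, v⟫ := by rw [hv, ← inner_neg_right, neg_sub]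
    have hαv : (α * ‖v‖) ^ 2 = N ^ 2 * (‖v‖ ^ (q - 1) / ε) ^ 2 := by
      rw [hpow, hα]
      ring
    rw [norm_add_sq_real, real_inner_smul_right, norm_smul, Real.norm_of_nonneg (by positivity),
      hαv] at hsq
    rw [hxy]
    have : 2 * (N / ε) * ‖v‖ ^ (q - 2) * -⟪g, v⟫ = -(2 * (α * ⟪g, v⟫)) := by rw [hα]; ring
    rw [this]
    have h1 : (1 / ε * ‖v‖ ^ (q - 1)) ^ 2 = (‖v‖ ^ (q - 1) / ε) ^ 2 := by ring
    rw [h1] at hsq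
    linarith
end

section
/- Let μ, ε > 0 and let f : ℝ^d → ℝ be differentiable, μ-strongly convex, with (1/ε)-Lipschitz gradient, attaining its minimum at x*. Let (τ_k)_{k≥0} be a sequence in (0,1). Suppose sequences (x_k), (y_k), (z_k) in ℝ^d satisfy, for all k: x_k = (τ_k/(1+τ_k)) z_k + (1/(1+τ_k)) y_k and z_{k+1} − z_k = τ_k ( x_k − z_k − (1/μ) ∇f(x_k) ). Then for all k, the quantity Ẽ_k = f(y_k) − f(x*) + (μ/2)‖x* − z_k‖² satisfies Ẽ_{k+1} − Ẽ_k ≤ −τ_k Ẽ_k + ( f(y_{k+1}) − f(x_k) + (τ_k²/(2μ)) ‖∇f(x_k)‖² + ( τ_k/(2ε) − μ/(2τ_k) ) ‖x_k − y_k‖² ). -/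
open scoped RealInnerProductSpace

/-- Strong convexity forces the modulus below the Lipschitz constant of the gradient. -/
theorem modulus_mul_sq_le_of_gradient_lipschitz
    {E : Type*} [NormedAddCommGroup E] [InnerProductSpace ℝ E] [CompleteSpace E]
    {μ L : ℝ} {f : E → ℝ}
    (hstrong : ∀ x y : E, f x + ⟪gradient f x, y - x⟫ + μ / 2 * ‖y - x‖ ^ 2 ≤ f y)
    (hlip : ∀ u v : E, ‖gradient f u - gradient f v‖ ≤ L * ‖u - v‖) (a b : E) :
    μ * ‖a - b‖ ^ 2 ≤ L * ‖a - b‖ ^ 2 := by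
  have h₁ := hstrong a b
  have h₂ := hstrong b a
  rw [← neg_sub a b, inner_neg_right, norm_neg] at h₁
  have h₃ := real_inner_le_norm (gradient f a - gradient f b) (a - b)
  rw [inner_sub_left] at h₃
  nlinarith [mul_le_mul_of_nonneg_right (hlip a b) (norm_nonneg (a - b))]

/-- Initial error bound for the strongly convex accelerated gradient family (Euclidean
case): with `Ẽ_k = f(y_k) - f(x*) + (μ/2)‖x* - z_k‖²`,
`Ẽ_{k+1} - Ẽ_k ≤ -τ_k Ẽ_k + (f(y_{k+1}) - f(x_k) + (τ_k²/(2μ))‖∇f(x_k)‖²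
  + (τ_k/(2ε) - μ/(2τ_k))‖x_k - y_k‖²)`. -/
theorem strongly_convex_accelerated_error_bound
    {E : Type*} [NormedAddCommGroup E] [InnerProductSpace ℝ E] [FiniteDimensional ℝ E]
    (μ ε : ℝ) (hμ : 0 < μ) (hε : 0 < ε)
    (f : E → ℝ) (hf : Differentiable ℝ f)
    (hstrong : ∀ x y : E, f x + ⟪gradient f x, y - x⟫ + μ / 2 * ‖y - x‖ ^ 2 ≤ f y)
    (hlip : ∀ u v : E, ‖gradient f u - gradient f v‖ ≤ (1 / ε) * ‖u - v‖)
    (xstar : E) (hmin : ∀ w : E, f xstar ≤ f w)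
    (τ : ℕ → ℝ) (hτ : ∀ k, 0 < τ k ∧ τ k < 1)
    (x y z : ℕ → E)
    (hcoup : ∀ k, x k = (τ k / (1 + τ k)) • z k + (1 / (1 + τ k)) • y k)
    (hzup : ∀ k, z (k+1) - z k = τ k • (x k - z k - (1 / μ) • gradient f (x k))) :
    ∀ k : ℕ,
      (f (y (k+1)) - f xstar + μ / 2 * ‖xstar - z (k+1)‖ ^ 2)
          - (f (y k) - f xstar + μ / 2 * ‖xstar - z k‖ ^ 2)
        ≤ -(τ k) * (f (y k) - f xstar + μ / 2 * ‖xstar - z k‖ ^ 2)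
          + (f (y (k+1)) - f (x k) + (τ k) ^ 2 / (2 * μ) * ‖gradient f (x k)‖ ^ 2
            + (τ k / (2 * ε) - μ / (2 * τ k)) * ‖x k - y k‖ ^ 2) := by
  intro k
  obtain ⟨ht, ht1⟩ := hτ k
  have hx := hcoup k
  have hz := hzup k
  have hsx := hstrong (x k) xstar
  have hsy := hstrong (x k) (y k)
  have hmod := modulus_mul_sq_le_of_gradient_lipschitz hstrong hlip (x k) (y k)
  set t := τ k
  set g := gradient f (x k)
  set s := xstar - x k with hs
  set v := z k - x k with hv
  have ht' : 1 + t ≠ 0 := by positivity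
  have hxy : x k - y k = t • v := by
    have h : (1 + t) • x k = t • z k + y k := by
      conv_lhs => rw [hx]
      rw [smul_add, smul_smul, smul_smul, mul_div_cancel₀ _ ht', mul_div_cancel₀ _ ht', one_smul]
    rw [add_smul, one_smul] at h
    rw [hv, smul_sub, sub_eq_sub_iff_add_eq_add, add_comm (t • z k), add_comm (y k), ← h]
  have hzk : xstar - z k = s - v := by rw [hs, hv]; abel
  have hzk1 : xstar - z (k + 1) = s - v + t • (v + (1 / μ) • g) := by
    rw [← sub_add_cancel (z (k + 1)) (z k), hz, hs, hv]
    module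
  have hyx : y k - x k = -(t • v) := by rw [← hxy]; abel
  have hnorm : ‖t • v‖ ^ 2 = t ^ 2 * ‖v‖ ^ 2 := by
    rw [norm_smul, mul_pow, Real.norm_eq_abs, sq_abs]
  rw [hyx, inner_neg_right, norm_neg, inner_smul_right, hnorm] at hsy
  rw [hxy, hnorm] at hmod
  have hdist : μ / 2 * ‖xstar - z (k + 1)‖ ^ 2 = μ / 2 * ‖xstar - z k‖ ^ 2
      - t * μ / 2 * (‖v‖ ^ 2 + ‖xstar - z k‖ ^ 2 - ‖s‖ ^ 2) - t * (⟪g, v⟫ - ⟪g, s⟫)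
      + μ * t ^ 2 / 2 * ‖v‖ ^ 2 + t ^ 2 * ⟪g, v⟫ + t ^ 2 / (2 * μ) * ‖g‖ ^ 2 := by
    rw [hzk1, hzk]
    simp only [← real_inner_self_eq_norm_sq, inner_add_left, inner_add_right, inner_sub_left,
      inner_sub_right, inner_smul_left, inner_smul_right, conj_trivial,
      real_inner_comm g v, real_inner_comm g s, real_inner_comm s v]
    field_simp
    ring
  have hcoef : (t / (2 * ε) - μ / (2 * t)) * (t ^ 2 * ‖v‖ ^ 2)
      = t / 2 * (1 / ε * (t ^ 2 * ‖v‖ ^ 2)) - μ * t / 2 * ‖v‖ ^ 2 := by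
    field_simp
  rw [hdist, hxy, hnorm, hcoef]
  linarith [mul_le_mul_of_nonneg_left hsx ht.le,
    mul_le_mul_of_nonneg_left hsy (sub_nonneg.2 ht1.le),
    mul_le_mul_of_nonneg_left hmod (half_pos ht).le]
end

section
/- Let μ, ε > 0 with με ≤ 1, and let f : ℝ^d → ℝ be differentiable, μ-strongly convex, with (1/ε)-Lipschitz gradient, attaining its minimum at x*. Let (τ_k)_{k≥0} be a sequence with 0 < τ_k ≤ √(με) for all k. Suppose sequences (x_k), (y_k), (z_k) in ℝ^d satisfy, for all k: x_k = (τ_k/(1+τ_k)) z_k + (1/(1+τ_k)) y_k, z_{k+1} − z_k = τ_k ( x_k − z_k − (1/μ) ∇f(x_k) ), and y_{k+1} = x_k − ε ∇f(x_k). Then Ẽ_k = f(y_k) − f(x*) + (μ/2)‖x* − z_k‖² satisfies Ẽ_{k+1} ≤ (1 − τ_k) Ẽ_k for all k; in particular, taking τ_k = √(με) for all k yields Ẽ_k ≤ (1 − √(με))^k Ẽ_0. -/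
open scoped RealInnerProductSpace

/-- Descent lemma: the quadratic upper bound for a function with Lipschitz gradient. -/
theorem le_add_inner_gradient_add_of_lipschitz
    {E : Type*} [NormedAddCommGroup E] [InnerProductSpace ℝ E] [CompleteSpace E]
    {f : E → ℝ} {L : ℝ} (hf : Differentiable ℝ f)
    (hlip : ∀ u v : E, ‖gradient f u - gradient f v‖ ≤ L * ‖u - v‖) (x d : E) :
    f (x + d) ≤ f x + ⟪gradient f x, d⟫ + L / 2 * ‖d‖ ^ 2 := by
  have hline (t : ℝ) : HasDerivAt (fun t : ℝ => x + t • d) d t := by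
    simpa using ((hasDerivAt_id t).smul_const d).const_add x
  have hcomp (t : ℝ) : HasDerivAt (fun t : ℝ => f (x + t • d)) ⟪gradient f (x + t • d), d⟫ t := by
    have h := (hf (x + t • d)).hasGradientAt.hasFDerivAt.comp_hasDerivAt t (hline t)
    rwa [InnerProductSpace.toDual_apply_apply] at h
  have hderiv (t : ℝ) : HasDerivAt
      (fun t : ℝ => f (x + t • d) - t * ⟪gradient f x, d⟫ - t ^ 2 * (L / 2 * ‖d‖ ^ 2))
      (⟪gradient f (x + t • d), d⟫ - ⟪gradient f x, d⟫ - 2 * t * (L / 2 * ‖d‖ ^ 2)) t := by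
    refine (((hcomp t).sub ((hasDerivAt_id t).mul_const _)).sub
      ((hasDerivAt_pow 2 t).mul_const (L / 2 * ‖d‖ ^ 2))).congr_deriv ?_
    simp
  have hanti : AntitoneOn
      (fun t : ℝ => f (x + t • d) - t * ⟪gradient f x, d⟫ - t ^ 2 * (L / 2 * ‖d‖ ^ 2))
      (Set.Icc 0 1) := by
    refine antitoneOn_of_deriv_nonpos (convex_Icc 0 1)
      (fun t _ => (hderiv t).continuousAt.continuousWithinAt)
      (fun t _ => (hderiv t).differentiableAt.differentiableWithinAt) fun t ht => ?_
    rw [interior_Icc] at ht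
    rw [(hderiv t).deriv, ← inner_sub_left]
    have hgrad : ‖gradient f (x + t • d) - gradient f x‖ ≤ L * (t * ‖d‖) := by
      simpa [norm_smul, abs_of_pos ht.1] using hlip (x + t • d) x
    nlinarith [real_inner_le_norm (gradient f (x + t • d) - gradient f x) d,
      mul_le_mul_of_nonneg_right hgrad (norm_nonneg d)]
  have h := hanti (Set.left_mem_Icc.2 zero_le_one) (Set.right_mem_Icc.2 zero_le_one) zero_le_one
  simp only [one_smul, zero_smul, add_zero] at h
  linarith

/-- Linear convergence of accelerated gradient descent in the strongly convex setting:
with `Ẽ_k = f(y_k) - f(x*) + (μ/2)‖x* - z_k‖²` and step sizes `0 < τ_k ≤ √(με)`,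
`Ẽ_{k+1} ≤ (1 - τ_k) Ẽ_k`; in particular `τ_k = √(με)` yields
`Ẽ_k ≤ (1 - √(με))^k Ẽ_0`. -/
theorem strongly_convex_accelerated_convergence
    {E : Type*} [NormedAddCommGroup E] [InnerProductSpace ℝ E] [FiniteDimensional ℝ E]
    (μ ε : ℝ) (hμ : 0 < μ) (hε : 0 < ε) (hμε : μ * ε ≤ 1)
    (f : E → ℝ) (hf : Differentiable ℝ f)
    (hstrong : ∀ x y : E, f x + ⟪gradient f x, y - x⟫ + μ / 2 * ‖y - x‖ ^ 2 ≤ f y)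
    (hlip : ∀ u v : E, ‖gradient f u - gradient f v‖ ≤ (1 / ε) * ‖u - v‖)
    (xstar : E) (hmin : ∀ w : E, f xstar ≤ f w)
    (τ : ℕ → ℝ) (hτ : ∀ k, 0 < τ k ∧ τ k ≤ Real.sqrt (μ * ε))
    (x y z : ℕ → E)
    (hcoup : ∀ k, x k = (τ k / (1 + τ k)) • z k + (1 / (1 + τ k)) • y k)
    (hzup : ∀ k, z (k+1) - z k = τ k • (x k - z k - (1 / μ) • gradient f (x k)))
    (hgrad : ∀ k, y (k+1) = x k - ε • gradient f (x k)) :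
    (∀ k : ℕ,
      f (y (k+1)) - f xstar + μ / 2 * ‖xstar - z (k+1)‖ ^ 2
        ≤ (1 - τ k) * (f (y k) - f xstar + μ / 2 * ‖xstar - z k‖ ^ 2)) ∧
    ((∀ k, τ k = Real.sqrt (μ * ε)) →
      ∀ k : ℕ,
        f (y k) - f xstar + μ / 2 * ‖xstar - z k‖ ^ 2
          ≤ (1 - Real.sqrt (μ * ε)) ^ k
            * (f (y 0) - f xstar + μ / 2 * ‖xstar - z 0‖ ^ 2)) := by
  have hτ1 (k : ℕ) : τ k ≤ 1 := (hτ k).2.trans (Real.sqrt_le_one.2 hμε)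
  have hstep (k : ℕ) : f (y (k+1)) - f xstar + μ / 2 * ‖xstar - z (k+1)‖ ^ 2
      ≤ (1 - τ k) * (f (y k) - f xstar + μ / 2 * ‖xstar - z k‖ ^ 2) := by
    have hτ0 : 0 < τ k := (hτ k).1
    have hτsq : τ k ^ 2 ≤ μ * ε := (Real.le_sqrt' hτ0).1 (hτ k).2
    set g := gradient f (x k)
    set u := z k - xstar with hu
    set v := x k - xstar with hv
    have hyx : y k - x k = τ k • (v - u) := by
      have hx : (1 + τ k) • x k = τ k • z k + y k := by
        rw [hcoup k, smul_add, smul_smul, smul_smul, mul_div_cancel₀ _ (by positivity),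
          mul_one_div_cancel (by positivity), one_smul]
      have hy : y k = (1 + τ k) • x k - τ k • z k := by rw [hx]; abel
      rw [hy, hu, hv]
      module
    have hz : xstar - z (k+1) = -((1 - τ k) • u + τ k • v - (τ k / μ) • g) := by
      rw [← sub_add_cancel (z (k+1)) (z k), hzup k, hu, hv]
      module
    have hdescent : f (y (k+1)) ≤ f (x k) - ε / 2 * ‖g‖ ^ 2 := by
      have h := le_add_inner_gradient_add_of_lipschitz hf hlip (x k) (-(ε • g))
      rw [← sub_eq_add_neg, ← hgrad k, inner_neg_right, real_inner_smul_right,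
        real_inner_self_eq_norm_sq, norm_neg, norm_smul, Real.norm_of_nonneg hε.le] at h
      have hquad : 1 / ε / 2 * (ε * ‖g‖) ^ 2 = ε / 2 * ‖g‖ ^ 2 := by field_simp
      linarith
    have hstar : f (x k) - ⟪g, v⟫ + μ / 2 * ‖v‖ ^ 2 ≤ f xstar := by
      have h := hstrong (x k) xstar
      rw [← neg_sub (x k) xstar, inner_neg_right, norm_neg] at h
      linarith
    have hy : f (x k) + τ k * (⟪g, v⟫ - ⟪g, u⟫) ≤ f (y k) := by
      have h := hstrong (x k) (y k)
      rw [hyx, real_inner_smul_right, inner_sub_right] at h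
      have : 0 ≤ μ / 2 * ‖τ k • (v - u)‖ ^ 2 := by positivity
      linarith
    have hnorm : μ / 2 * ‖xstar - z (k+1)‖ ^ 2 =
        μ / 2 * ((1 - τ k) * ‖u‖ ^ 2 + τ k * ‖v‖ ^ 2 - τ k * (1 - τ k) * ‖u - v‖ ^ 2)
          - τ k * ((1 - τ k) * ⟪g, u⟫ + τ k * ⟪g, v⟫) + τ k ^ 2 / μ / 2 * ‖g‖ ^ 2 := by
      rw [hz, norm_neg]
      simp only [← real_inner_self_eq_norm_sq, inner_sub_left, inner_sub_right, inner_add_left,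
        inner_add_right, real_inner_smul_left, real_inner_smul_right]
      rw [real_inner_comm g u, real_inner_comm g v, real_inner_comm u v]
      field_simp
      ring
    have hgsq : τ k ^ 2 / μ / 2 * ‖g‖ ^ 2 ≤ ε / 2 * ‖g‖ ^ 2 := by
      gcongr
      rwa [div_le_iff₀' hμ]
    have hcross : 0 ≤ μ / 2 * (τ k * (1 - τ k) * ‖u - v‖ ^ 2) := by
      have := sub_nonneg.2 (hτ1 k)
      positivity
    rw [hnorm, norm_sub_rev xstar (z k), ← hu]
    linarith [mul_le_mul_of_nonneg_left hstar hτ0.le,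
      mul_le_mul_of_nonneg_left hy (sub_nonneg.2 (hτ1 k))]
  refine ⟨hstep, fun hconst k => ?_⟩
  induction k with
  | zero => simp
  | succ k ih =>
    refine (hstep k).trans ?_
    rw [pow_succ' (1 - √(μ * ε)), mul_assoc, hconst k]
    exact mul_le_mul_of_nonneg_left ih (sub_nonneg.2 (Real.sqrt_le_one.2 hμε))
end

section
/- Let 𝒳 ⊆ ℝ^d be a convex set, let f : ℝ^d → ℝ be convex and differentiable, and let β : ℝ → ℝ be differentiable with β̇_t > 0 for all t. Suppose X : ℝ → 𝒳 is a differentiable curve such that, setting Z_t = X_t + β̇_t^{-1} Ẋ_t, one has Z_t ∈ 𝒳 and ⟨∇f(X_t), x − Z_t⟩ ≥ 0 for all x ∈ 𝒳 and all t. Then for every x ∈ 𝒳, the function E_t = e^{β_t} ( f(X_t) − f(x) ) satisfies dE_t/dt ≤ 0 for all t; in particular f(X_t) − f(x) ≤ e^{β_0 − β_t} ( f(X_0) − f(x) ). -/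
open scoped RealInnerProductSpace

/-- Continuous-time Frank-Wolfe: if `Z_t = X_t + β̇_t⁻¹ Ẋ_t ∈ 𝒳` satisfies the
variational inequality `⟪∇f(X_t), x - Z_t⟫ ≥ 0` for all `x ∈ 𝒳`, then
`E_t = e^{β_t}(f(X_t) - f(x))` is a Lyapunov function, so
`f(X_t) - f(x) ≤ e^{β_0 - β_t}(f(X_0) - f(x))`. -/
theorem frank_wolfe_continuous_lyapunov
    {E : Type*} [NormedAddCommGroup E] [InnerProductSpace ℝ E] [FiniteDimensional ℝ E]
    (𝒳 : Set E) (h𝒳 : Convex ℝ 𝒳)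
    (f : E → ℝ) (hf : Differentiable ℝ f)
    (hconv : ∀ x y : E, f x + ⟪gradient f x, y - x⟫ ≤ f y)
    (β β' : ℝ → ℝ) (hβ : ∀ t, HasDerivAt β (β' t) t) (hβpos : ∀ t, 0 < β' t)
    (X X' : ℝ → E) (hX : ∀ t, HasDerivAt X (X' t) t) (hXmem : ∀ t, X t ∈ 𝒳)
    (Z : ℝ → E) (hZ : ∀ t, Z t = X t + (β' t)⁻¹ • X' t) (hZmem : ∀ t, Z t ∈ 𝒳)
    (hvar : ∀ t, ∀ x ∈ 𝒳, 0 ≤ ⟪gradient f (X t), x - Z t⟫) :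
    ∀ x ∈ 𝒳,
      (∀ t, deriv (fun s => Real.exp (β s) * (f (X s) - f x)) t ≤ 0) ∧
      (∀ t, 0 ≤ t → f (X t) - f x ≤ Real.exp (β 0 - β t) * (f (X 0) - f x)) := by
  intro x hx
  have hE (t : ℝ) : HasDerivAt (fun s => Real.exp (β s) * (f (X s) - f x))
      (Real.exp (β t) * β' t * (f (X t) - f x) +
        Real.exp (β t) * ⟪gradient f (X t), X' t⟫) t := by
    have hfX : HasDerivAt (fun s => f (X s)) ⟪gradient f (X t), X' t⟫ t := by
      exact (hf (X t)).hasGradientAt.hasFDerivAt.comp_hasDerivAt t (hX t)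
    exact (hβ t).exp.mul (hfX.sub_const (f x))
  have hderiv (t : ℝ) : deriv (fun s => Real.exp (β s) * (f (X s) - f x)) t ≤ 0 := by
    have hX' : X' t = β' t • (Z t - X t) := by
      rw [hZ, add_sub_cancel_left, smul_inv_smul₀ (hβpos t).ne']
    have hgap : f (X t) - f x + ⟪gradient f (X t), Z t - X t⟫ ≤ 0 := by
      have h₁ := hvar t x hx
      have h₂ := hconv (X t) x
      rw [inner_sub_right] at h₁ h₂ ⊢
      linarith
    rw [(hE t).deriv, hX', real_inner_smul_right]
    calc _ = Real.exp (β t) * β' t * (f (X t) - f x + ⟪gradient f (X t), Z t - X t⟫) := by ring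
      _ ≤ 0 := mul_nonpos_of_nonneg_of_nonpos
        (mul_nonneg (Real.exp_pos _).le (hβpos t).le) hgap
  refine ⟨hderiv, fun t ht => ?_⟩
  have hmono := antitone_of_deriv_nonpos (fun t => (hE t).differentiableAt) hderiv ht
  rw [Real.exp_sub, div_mul_eq_mul_div, le_div_iff₀ (Real.exp_pos _), mul_comm]
  exact hmono
end

section
/- Let 𝒳 ⊆ ℝ^d be convex and compact, let ν ∈ (0,1], ε > 0, and let f : ℝ^d → ℝ be convex and differentiable with (ε,ν)-Hölder-continuous gradient: ‖∇f(x) − ∇f(y)‖ ≤ (1/ε)‖x − y‖^ν for all x, y. Let (A_k)_{k≥0} be a strictly increasing sequence of positive reals and set τ_k = (A_{k+1} − A_k)/A_{k+1}. Suppose sequences (x_k), (z_k) in 𝒳 satisfy, for all k: ⟨∇f(x_k), z_k⟩ ≤ ⟨∇f(x_k), z⟩ for all z ∈ 𝒳, and x_{k+1} = τ_k z_k + (1 − τ_k) x_k. Then, for any x ∈ 𝒳, the quantity E_k = A_k ( f(x_k) − f(x) ) satisfies E_{k+1} − E_k ≤ ( A_{k+1} τ_k^{1+ν} / ((1+ν)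 ε) ) ‖z_k − x_k‖^{1+ν} for all k. -/
open scoped RealInnerProductSpace

/-- Descent lemma for functions with Hölder-continuous gradient. -/
theorem le_add_inner_gradient_add_rpow_of_holder
    {E : Type*} [NormedAddCommGroup E] [InnerProductSpace ℝ E] [CompleteSpace E]
    {ν C : ℝ} (hν : 0 ≤ ν) {f : E → ℝ} (hf : Differentiable ℝ f)
    (hhold : ∀ x y : E, ‖gradient f x - gradient f y‖ ≤ C * ‖x - y‖ ^ ν) (x v : E) :
    f (x + v) ≤ f x + ⟪gradient f x, v⟫ + C / (1 + ν) * ‖v‖ ^ (1 + ν) := by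
  have hν' : 0 < 1 + ν := by linarith
  have hφ (t : ℝ) : HasDerivAt (fun t : ℝ => f (x + t • v)) ⟪gradient f (x + t • v), v⟫ t := by
    have hline : HasDerivAt (fun t : ℝ => x + t • v) v t := by
      simpa using ((hasDerivAt_id t).smul_const v).const_add x
    exact ((hf (x + t • v)).hasGradientAt.hasFDerivAt.comp_hasDerivAt t hline).congr_deriv
      (InnerProductSpace.toDual_apply_apply ..)
  have hB (t : ℝ) : HasDerivAt
      (fun t : ℝ => f x + t * ⟪gradient f x, v⟫ + C / (1 + ν) * ‖v‖ ^ (1 + ν) * t ^ (1 + ν))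
      (⟪gradient f x, v⟫ + C * ‖v‖ ^ (1 + ν) * t ^ ν) t := by
    have hpow := (Real.hasDerivAt_rpow_const (x := t) (p := 1 + ν)
      (Or.inr (by linarith))).const_mul (C / (1 + ν) * ‖v‖ ^ (1 + ν))
    refine ((((hasDerivAt_id t).mul_const ⟪gradient f x, v⟫).const_add (f x)).add
      hpow).congr_deriv ?_
    rw [add_sub_cancel_left]
    field_simp
  have key := image_le_of_deriv_right_le_deriv_boundary (a := 0) (b := 1)
    (fun t _ => (hφ t).continuousAt.continuousWithinAt)
    (fun t _ => (hφ t).hasDerivWithinAt)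
    (by simp [Real.zero_rpow hν'.ne'])
    (fun t _ => (hB t).continuousAt.continuousWithinAt)
    (fun t _ => (hB t).hasDerivWithinAt)
    (fun t ht => by
      have h := hhold (x + t • v) x
      rw [add_sub_cancel_left, norm_smul, Real.norm_of_nonneg ht.1,
        Real.mul_rpow ht.1 (norm_nonneg v)] at h
      have hinner := real_inner_le_norm (gradient f (x + t • v) - gradient f x) v
      rw [inner_sub_left] at hinner
      have hmul := mul_le_mul_of_nonneg_right h (norm_nonneg v)
      rw [Real.rpow_add' (norm_nonneg v) hν'.ne', Real.rpow_one]
      linarith)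
    (Set.right_mem_Icc.2 zero_le_one)
  simpa using key

/-- Error bound for the Frank-Wolfe (conditional gradient) algorithm under
`(ε,ν)`-Hölder-continuous gradients: with `E_k = A_k (f(x_k) - f(x))` and
`τ_k = (A_{k+1} - A_k)/A_{k+1}`,
`E_{k+1} - E_k ≤ (A_{k+1} τ_k^{1+ν} / ((1+ν)ε)) ‖z_k - x_k‖^{1+ν}`. -/
theorem frank_wolfe_error_bound
    {E : Type*} [NormedAddCommGroup E] [InnerProductSpace ℝ E] [FiniteDimensional ℝ E]
    (𝒳 : Set E) (h𝒳conv : Convex ℝ 𝒳) (h𝒳comp : IsCompact 𝒳)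
    (ν ε : ℝ) (hν : 0 < ν) (hν1 : ν ≤ 1) (hε : 0 < ε)
    (f : E → ℝ) (hf : Differentiable ℝ f)
    (hconv : ∀ x y : E, f x + ⟪gradient f x, y - x⟫ ≤ f y)
    (hhold : ∀ x y : E, ‖gradient f x - gradient f y‖ ≤ (1 / ε) * ‖x - y‖ ^ ν)
    (A : ℕ → ℝ) (hApos : ∀ k, 0 < A k) (hAmono : StrictMono A)
    (x z : ℕ → E) (hxmem : ∀ k, x k ∈ 𝒳) (hzmem : ∀ k, z k ∈ 𝒳)
    (hlin : ∀ k, ∀ w ∈ 𝒳, ⟪gradient f (x k), z k⟫ ≤ ⟪gradient f (x k), w⟫)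
    (hup : ∀ k, x (k+1) = ((A (k+1) - A k) / A (k+1)) • z k
      + (1 - (A (k+1) - A k) / A (k+1)) • x k) :
    ∀ w ∈ 𝒳, ∀ k : ℕ,
      A (k+1) * (f (x (k+1)) - f w) - A k * (f (x k) - f w)
        ≤ A (k+1) * ((A (k+1) - A k) / A (k+1)) ^ (1 + ν) / ((1 + ν) * ε)
            * ‖z k - x k‖ ^ (1 + ν) := by
  intro w hw k
  have hA : 0 < A (k + 1) := hApos (k + 1)
  have hlt : A k < A (k + 1) := hAmono k.lt_succ_self
  set τ := (A (k + 1) - A k) / A (k + 1) with hτ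
  have hτ0 : 0 ≤ τ := div_nonneg (by linarith) hA.le
  have hAτ : A (k + 1) * τ = A (k + 1) - A k := by rw [hτ]; field_simp
  have hstep : x (k + 1) = x k + τ • (z k - x k) := by rw [hup k]; module
  have hdesc := le_add_inner_gradient_add_rpow_of_holder hν.le hf hhold (x k) (τ • (z k - x k))
  rw [← hstep, real_inner_smul_right, norm_smul, Real.norm_of_nonneg hτ0,
    Real.mul_rpow hτ0 (norm_nonneg _), inner_sub_right] at hdesc
  have hsub := hconv (x k) w
  rw [inner_sub_right] at hsub
  have hmin := hlin k w hw
  have hgap : f (x k) + (⟪gradient f (x k), z k⟫ - ⟪gradient f (x k), x k⟫) ≤ f w := by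
    linarith
  calc
    _ = A (k + 1) * (f (x (k + 1)) - f (x k)) + A (k + 1) * τ * (f (x k) - f w) := by
      rw [hAτ]; ring
    _ ≤ A (k + 1) * (1 / ε / (1 + ν) * (τ ^ (1 + ν) * ‖z k - x k‖ ^ (1 + ν))) := by
      have h₁ := mul_le_mul_of_nonneg_left hdesc hA.le
      have h₂ := mul_le_mul_of_nonneg_left hgap (mul_nonneg hA.le hτ0)
      linarith
    _ = _ := by field_simp
end

section
/- Let φ, ψ : ℝ^d → ℝ be convex and differentiable, set f = φ + ψ, let h : ℝ^d → ℝ be differentiable, and let α, β : ℝ → ℝ be differentiable with β̇_t = e^{α_t} for all t. Suppose X : ℝ → ℝ^d is a twice differentiable curve such that, setting Z_t = X_t + e^{-α_t} Ẋ_t, the curve satisfies (d/dt) ∇h(Z_t) = − e^{α_t + β_t} ( ∇φ(X_t) + ∇ψ(Z_t) ) for all t. Then for every x ∈ ℝ^d, the function E_t = D_h(x, Z_t) + e^{β_t} ( f(X_t) − f(x) ) satisfies dE_t/dt ≤ 0 for all t. -/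
open scoped RealInnerProductSpace

/-- Chain rule for the composition of a scalar function with a curve, in gradient form. -/
theorem HasGradientAt.hasDerivAt_comp_curve {E : Type*} [NormedAddCommGroup E]
    [InnerProductSpace ℝ E] [CompleteSpace E] {g : E → ℝ} {g' : E} {c : ℝ → E} {c' : E} {t : ℝ}
    (hg : HasGradientAt g g' (c t)) (hc : HasDerivAt c c' t) :
    HasDerivAt (fun s => g (c s)) ⟪g', c'⟫ t := by
  exact (hg.hasFDerivAt.comp_hasDerivAt t hc).congr_deriv (by simp)

/-- Along a curve `Z`, the Bregman divergence `D_h(x, Z)` has derivative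
`-⟪d/dt ∇h(Z), x - Z⟫`. -/
theorem hasDerivAt_breg_curve {E : Type*} [NormedAddCommGroup E]
    [InnerProductSpace ℝ E] [CompleteSpace E] {h : E → ℝ} {Z : ℝ → E} {Z' G' : E} {t : ℝ}
    (hh : DifferentiableAt ℝ h (Z t)) (hZ : HasDerivAt Z Z' t)
    (hG : HasDerivAt (fun s => gradient h (Z s)) G' t) (x : E) :
    HasDerivAt (fun s => breg h x (Z s)) (-⟪G', x - Z t⟫) t := by
  have hhZ := hh.hasGradientAt.hasDerivAt_comp_curve hZ
  refine ((hhZ.const_sub (h x)).sub (hG.inner ℝ (hZ.const_sub x))).congr_deriv ?_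
  rw [inner_neg_right]
  ring

/-- Lyapunov function for the proximal (composite) momentum dynamics: for `f = φ + ψ`
with `φ, ψ` convex, if `Z_t = X_t + e^{-α_t} Ẋ_t` satisfies
`d/dt ∇h(Z_t) = -e^{α_t+β_t} (∇φ(X_t) + ∇ψ(Z_t))` and `β̇_t = e^{α_t}`, then
`E_t = D_h(x, Z_t) + e^{β_t}(f(X_t) - f(x))` has nonpositive time derivative. -/
theorem lyapunov_proximal_dynamics
    {E : Type*} [NormedAddCommGroup E] [InnerProductSpace ℝ E] [FiniteDimensional ℝ E]
    (φ ψ h : E → ℝ) (hφ : Differentiable ℝ φ) (hψ : Differentiable ℝ ψ)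
    (hh : Differentiable ℝ h)
    (hφconv : ∀ x y : E, φ x + ⟪gradient φ x, y - x⟫ ≤ φ y)
    (hψconv : ∀ x y : E, ψ x + ⟪gradient ψ x, y - x⟫ ≤ ψ y)
    (α β : ℝ → ℝ) (hα : Differentiable ℝ α)
    (hβ : ∀ t, HasDerivAt β (Real.exp (α t)) t)
    (X X' X'' : ℝ → E)
    (hX : ∀ t, HasDerivAt X (X' t) t) (hX' : ∀ t, HasDerivAt X' (X'' t) t)
    (Z : ℝ → E) (hZ : ∀ t, Z t = X t + Real.exp (-α t) • X' t)
    (hode : ∀ t, HasDerivAt (fun s => gradient h (Z s))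
      (-(Real.exp (α t + β t)) • (gradient φ (X t) + gradient ψ (Z t))) t) :
    ∀ x : E, ∀ t,
      deriv (fun s => breg h x (Z s)
        + Real.exp (β s) * ((φ (X s) + ψ (X s)) - (φ x + ψ x))) t ≤ 0 := by
  intro x t
  have hZ' : HasDerivAt Z (X' t + (Real.exp (-α t) • X'' t
      + (Real.exp (-α t) * -deriv α t) • X' t)) t := by
    rw [funext hZ]
    exact (hX t).add ((hα t).hasDerivAt.neg.exp.smul (hX' t))
  have hX'eq : X' t = Real.exp (α t) • (Z t - X t) := by
    rw [hZ, add_sub_cancel_left, smul_smul, ← Real.exp_add, add_neg_cancel, Real.exp_zero,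
      one_smul]
  have hE := (hasDerivAt_breg_curve (hh (Z t)) hZ' (hode t) x).add
    ((hβ t).exp.mul
      ((((hφ (X t)).hasGradientAt.hasDerivAt_comp_curve (hX t)).add
        ((hψ (X t)).hasGradientAt.hasDerivAt_comp_curve (hX t))).sub_const (φ x + ψ x)))
  refine hE.deriv.trans_le ?_
  have hφx := hφconv (X t) x
  have hψx := hψconv (Z t) x
  have hψZ := hψconv (X t) (Z t)
  have hsplit : ⟪gradient φ (X t), x - X t⟫
      = ⟪gradient φ (X t), x - Z t⟫ + ⟪gradient φ (X t), Z t - X t⟫ := by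
    rw [← inner_add_right, sub_add_sub_cancel]
  have hbracket : ⟪gradient φ (X t), x - Z t⟫ + ⟪gradient ψ (Z t), x - Z t⟫
      + (φ (X t) + ψ (X t) - (φ x + ψ x))
      + (⟪gradient φ (X t), Z t - X t⟫ + ⟪gradient ψ (X t), Z t - X t⟫) ≤ 0 := by
    linarith
  have hscaled := mul_nonpos_of_nonneg_of_nonpos
    (mul_pos (Real.exp_pos (α t)) (Real.exp_pos (β t))).le hbracket
  simp only [hX'eq, inner_smul_left, inner_smul_right, inner_add_left, Real.exp_add,
    conj_trivial, Pi.add_apply]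
  linarith
end
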